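/- arXiv:2410.05524 — 10 statements merged into one kernel-verified Lean document; each statement's English description precedes it below -/
import Mathlib

section
/- For the power S-shaped utility with parameters p ∈ (0,1) and K ≥ 0, for every r > 0 there exists a unique η > r satisfying (η − r)^p + K r^p = p·η·(η − r)^{p−1}. -/
open Set Filter Topology

/-- Multiplying by `x ^ (1 - p)` turns the tangency equation, with `x = η - r`, into one whose
left-hand side is increasing in `x`. -/
lemma rpow_tangency_iff {p c r x : ℝ} (hx : 0 < x) :
    x ^ p + c = p * (x + r) * x ^ (p - 1) ↔ (1 - p) * x + c * x ^ (1 - p) = p * r := by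
  have hab : x ^ (p - 1) * x ^ (1 - p) = 1 := by
    rw [← Real.rpow_add hx]; simp
  have hxp : x ^ p = x * x ^ (p - 1) := by
    rw [Real.rpow_sub_one hx.ne']; field_simp
  rw [hxp]
  constructor <;> intro h
  · linear_combination x ^ (1 - p) * h + (p * (x + r) - x) * hab
  · linear_combination x ^ (p - 1) * h - c * hab

lemma strictMonoOn_mul_add_mul_rpow {a c q : ℝ} (ha : 0 < a) (hc : 0 ≤ c) (hq : 0 ≤ q) :
    StrictMonoOn (fun x : ℝ => a * x + c * x ^ q) (Ici 0) := by
  intro x hx y _ hxy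
  have h := mul_le_mul_of_nonneg_left (Real.rpow_le_rpow hx hxy.le hq) hc
  have h' := mul_lt_mul_of_pos_left hxy ha
  exact add_lt_add_of_lt_of_le h' h

lemma exists_pos_mul_add_mul_rpow_eq {a c q s : ℝ} (ha : 0 < a) (hc : 0 ≤ c) (hq : 0 < q)
    (hs : 0 < s) : ∃ x : ℝ, 0 < x ∧ a * x + c * x ^ q = s := by
  have hsa : 0 < s / a := div_pos hs ha
  have hcont : Continuous fun x : ℝ => a * x + c * x ^ q :=
    (continuous_const.mul continuous_id).add
      (continuous_const.mul (Real.continuous_rpow_const hq.le))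
  have hmem : s ∈ Icc (a * 0 + c * (0 : ℝ) ^ q) (a * (s / a) + c * (s / a) ^ q) := by
    rw [Real.zero_rpow hq.ne', mul_div_cancel₀ s ha.ne']
    have := mul_nonneg hc (Real.rpow_nonneg hsa.le q)
    constructor <;> linarith
  obtain ⟨x, hx, hxs⟩ := intermediate_value_Icc hsa.le hcont.continuousOn hmem
  refine ⟨x, lt_of_le_of_ne hx.1 ?_, hxs⟩
  rintro rfl
  simp [Real.zero_rpow hq.ne'] at hxs
  exact hs.ne hxs

/-- for the power S-shaped utility, existence and uniqueness of the
tangency point η > r. -/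
theorem power_tangency_exists_unique (p K : ℝ) (hp : 0 < p) (hp1 : p < 1) (hK : 0 ≤ K) :
    ∀ r > (0:ℝ), ∃! η : ℝ, η > r ∧
      (η - r) ^ p + K * r ^ p = p * η * (η - r) ^ (p - 1) := by
  intro r hr
  have hq : 0 < 1 - p := sub_pos.2 hp1
  have hc : 0 ≤ K * r ^ p := mul_nonneg hK (Real.rpow_nonneg hr.le p)
  obtain ⟨x, hx, hxs⟩ := exists_pos_mul_add_mul_rpow_eq hq hc hq (mul_pos hp hr)
  refine ⟨x + r, ⟨lt_add_of_pos_left r hx, ?_⟩, ?_⟩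
  · rw [add_sub_cancel_right]
    exact (rpow_tangency_iff hx).2 hxs
  · rintro η ⟨hη, h⟩
    have hy : 0 < η - r := sub_pos.2 hη
    have hys := (rpow_tangency_iff (r := r) hy).1 (by rwa [sub_add_cancel])
    exact sub_eq_iff_eq_add.1
      ((strictMonoOn_mul_add_mul_rpow hq hc hq.le).injOn hy.le hx.le (hys.trans hxs.symm))
end

section
/- Let U1, U2 : [0,∞) → ℝ be strictly increasing, strictly concave, continuously differentiable with U1(0) = U2(0) = 0, let r > 0, and let η > r satisfy the tangency equation U1(η − r) + U2(r) − η·U1'(η − r) = 0. Then the concavified utility x ↦ Ū(x, r), defined by Ū(x, r) = −U2(r) + x·U1'(η − r) for 0 ≤ x < η and Ū(x, r) = U1(x − r) for x ≥ η, is concave on [0,∞), strictly increasing on [0,∞), and continuously differentiable on (0,∞), with derivative U1'(η − r) on (0, η) and U1'(x − r) on [η, ∞). -/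
open Set Filter Topology

/-- A strictly concave, strictly increasing function has positive derivative at every point
of its domain that is not the largest one. -/
theorem StrictConcaveOn.hasDerivWithinAt_pos_of_strictMonoOn {S : Set ℝ} {f : ℝ → ℝ} {f' x y : ℝ}
    (hconc : StrictConcaveOn ℝ S f) (hmono : StrictMonoOn f S) (hx : x ∈ S) (hy : y ∈ S)
    (hxy : x < y) (hf : HasDerivWithinAt f f' S x) : 0 < f' := by
  refine lt_trans ?_ (hconc.slope_lt_of_hasDerivWithinAt hx hy hxy hf)
  rw [slope_def_field]
  exact div_pos (sub_pos.2 (hmono hx hy hxy)) (sub_pos.2 hxy)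

/-- Two functions that agree at `c` and have the same derivative there glue to a function
with that derivative. -/
theorem HasDerivAt.ite_lt {f g : ℝ → ℝ} {c d : ℝ} (hf : HasDerivAt f d c) (hg : HasDerivAt g d c)
    (hfg : f c = g c) : HasDerivAt (fun x => if x < c then f x else g x) d c := by
  rw [← hasDerivWithinAt_univ, ← Iic_union_Ici (a := c)]
  refine HasDerivWithinAt.union ?_ ?_
  · refine hf.hasDerivWithinAt.congr (fun x hx => ?_) (by simp [hfg])
    rcases (mem_Iic.1 hx).lt_or_eq with h | rfl
    · simp [h]
    · simp [hfg]
  · exact hg.hasDerivWithinAt.congr (fun x hx => if_neg (not_lt.2 hx)) (by simp)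

/-- the concavified utility is concave, strictly increasing, and
continuously differentiable on (0,∞) with the stated derivative. -/
theorem concavified_regularity (U1 U1' U2 U2' : ℝ → ℝ) (r η : ℝ)
    (hU1mono : StrictMonoOn U1 (Ici 0))
    (hU1conc : StrictConcaveOn ℝ (Ici 0) U1)
    (hU1deriv : ∀ z ∈ Ici (0:ℝ), HasDerivWithinAt U1 (U1' z) (Ici 0) z)
    (hU1derivCont : ContinuousOn U1' (Ici 0))
    (hU10 : U1 0 = 0)
    (hU2mono : StrictMonoOn U2 (Ici 0))
    (hU2conc : StrictConcaveOn ℝ (Ici 0) U2)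
    (hU2deriv : ∀ z ∈ Ici (0:ℝ), HasDerivWithinAt U2 (U2' z) (Ici 0) z)
    (hU2derivCont : ContinuousOn U2' (Ici 0))
    (hU20 : U2 0 = 0)
    (hr : 0 < r) (hη : r < η)
    (htan : U1 (η - r) + U2 r - η * U1' (η - r) = 0)
    (Ubar Ubar' : ℝ → ℝ)
    (hUbar : ∀ x, Ubar x = if x < η then -(U2 r) + x * U1' (η - r) else U1 (x - r))
    (hUbar' : ∀ x, Ubar' x = if x < η then U1' (η - r) else U1' (x - r)) :
    ConcaveOn ℝ (Ici 0) Ubar ∧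
    StrictMonoOn Ubar (Ici 0) ∧
    (∀ x ∈ Ioi (0:ℝ), HasDerivAt Ubar (Ubar' x) x) ∧
    ContinuousOn Ubar' (Ioi 0) := by
  have hU1at : ∀ x, η ≤ x → HasDerivAt (fun y => U1 (y - r)) (U1' (x - r)) x := by
    intro x hx
    have hpos : 0 < x - r := by linarith
    exact ((hU1deriv _ hpos.le).hasDerivAt (Ici_mem_nhds hpos)).comp_sub_const x r
  have hlin : ∀ x, HasDerivAt (fun y => -(U2 r) + y * U1' (η - r)) (U1' (η - r)) x := by
    intro x
    simpa using ((hasDerivAt_id x).mul_const (U1' (η - r))).const_add (-(U2 r))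
  have hder : ∀ x, HasDerivAt Ubar (Ubar' x) x := by
    intro x
    rw [funext hUbar, hUbar']
    rcases lt_trichotomy x η with h | rfl | h
    · rw [if_pos h]
      refine (hlin x).congr_of_eventuallyEq ?_
      filter_upwards [Iio_mem_nhds h] with y hy using if_pos hy
    · rw [if_neg (lt_irrefl _)]
      exact (hlin x).ite_lt (hU1at x le_rfl) (by linarith)
    · rw [if_neg h.not_gt]
      refine (hU1at x h.le).congr_of_eventuallyEq ?_
      filter_upwards [Ioi_mem_nhds h] with y hy using if_neg (not_lt.2 (mem_Ioi.1 hy).le)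
  have hUbar'_max : Ubar' = fun x => U1' (max x η - r) := by
    funext x
    rw [hUbar']
    split_ifs with h
    · rw [max_eq_right h.le]
    · rw [max_eq_left (not_lt.1 h)]
  have hmem : ∀ x, max x η - r ∈ Ici (0 : ℝ) := fun x =>
    mem_Ici.2 (by linarith [le_max_right x η])
  have hU1'anti : AntitoneOn U1' (Ici 0) := by
    intro x hx y hy hxy
    rcases hxy.eq_or_lt with rfl | hlt
    · exact le_rfl
    · exact ((hU1conc.lt_slope_of_hasDerivWithinAt hx hy hlt (hU1deriv y hy)).trans
        (hU1conc.slope_lt_of_hasDerivWithinAt hx hy hlt (hU1deriv x hx))).le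
  have hU1'pos : ∀ x ∈ Ici (0 : ℝ), 0 < U1' x := fun x hx =>
    hU1conc.hasDerivWithinAt_pos_of_strictMonoOn hU1mono hx
      (mem_Ici.2 (by linarith [mem_Ici.1 hx])) (lt_add_one x) (hU1deriv x hx)
  have hdiff : Differentiable ℝ Ubar := fun x => (hder x).differentiableAt
  have hderiv : deriv Ubar = Ubar' := funext fun x => (hder x).deriv
  refine ⟨?_, ?_, fun x _ => hder x, ?_⟩
  · refine AntitoneOn.concaveOn_of_deriv (convex_Ici 0) hdiff.continuous.continuousOn
      hdiff.differentiableOn ?_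
    rw [hderiv, hUbar'_max]
    intro x _ y _ hxy
    exact hU1'anti (hmem x) (hmem y) (sub_le_sub_right (max_le_max_right η hxy) r)
  · refine strictMonoOn_of_deriv_pos (convex_Ici 0) hdiff.continuous.continuousOn fun x _ => ?_
    rw [hderiv, hUbar'_max]
    exact hU1'pos _ (hmem x)
  · rw [hUbar'_max]
    exact (hU1derivCont.comp_continuous (by fun_prop) hmem).continuousOn
end

section
/- Let U1, U2 : [0,∞) → ℝ be strictly increasing, strictly concave, continuously differentiable with U1(0) = U2(0) = 0, let r > 0, and let η ≥ r satisfy the tangency equation U1(η − r) + U2(r) − η·U1'(η − r) = 0. Then the concavified utility majorizes the S-shaped utility: Ū(x, r) ≥ U(x − r) for every x ≥ 0, where U(z) = U1(z) for z ≥ 0 and U(z) = −U2(−z) for z < 0. -/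
open Set Filter Topology

/-- A concave function lies below its tangent line, to the left of the point of tangency. -/
lemma ConcaveOn.le_tangent_of_hasDerivWithinAt {S : Set ℝ} {f : ℝ → ℝ} {f' x y : ℝ}
    (hf : ConcaveOn ℝ S f) (hx : x ∈ S) (hy : y ∈ S) (hxy : x ≤ y)
    (hf' : HasDerivWithinAt f f' S y) : f x ≤ f y + f' * (x - y) := by
  rcases hxy.eq_or_lt with rfl | hlt
  · simp
  · have h := hf.le_slope_of_hasDerivWithinAt hx hy hlt hf'
    rw [slope_def_field, le_div_iff₀ (sub_pos.2 hlt)] at h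
    linarith

/-- A concave function on `[0, ∞)` vanishing at `0` lies above its chords from the origin. -/
lemma ConcaveOn.mul_le_mul_of_map_zero {f : ℝ → ℝ} {y r : ℝ} (hf : ConcaveOn ℝ (Ici 0) f)
    (hf0 : f 0 = 0) (hr : 0 < r) (hy : 0 ≤ y) (hyr : y ≤ r) : y * f r ≤ r * f y := by
  have h := hf.2 (mem_Ici.2 hr.le) (mem_Ici.2 le_rfl) (div_nonneg hy hr.le)
    (sub_nonneg.2 ((div_le_one hr).2 hyr)) (add_sub_cancel _ _)
  simp only [smul_eq_mul, hf0, mul_zero, add_zero, div_mul_cancel₀ y hr.ne'] at h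
  rwa [div_mul_eq_mul_div, div_le_iff₀' hr] at h

/-- the concavified utility majorizes the S-shaped utility. -/
theorem concavified_majorizes (U1 U1' U2 U2' : ℝ → ℝ) (r η : ℝ)
    (hU1mono : StrictMonoOn U1 (Ici 0))
    (hU1conc : StrictConcaveOn ℝ (Ici 0) U1)
    (hU1deriv : ∀ z ∈ Ici (0:ℝ), HasDerivWithinAt U1 (U1' z) (Ici 0) z)
    (hU1derivCont : ContinuousOn U1' (Ici 0))
    (hU10 : U1 0 = 0)
    (hU2mono : StrictMonoOn U2 (Ici 0))
    (hU2conc : StrictConcaveOn ℝ (Ici 0) U2)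
    (hU2deriv : ∀ z ∈ Ici (0:ℝ), HasDerivWithinAt U2 (U2' z) (Ici 0) z)
    (hU2derivCont : ContinuousOn U2' (Ici 0))
    (hU20 : U2 0 = 0)
    (hr : 0 < r) (hη : r ≤ η)
    (htan : U1 (η - r) + U2 r - η * U1' (η - r) = 0)
    (U Ubar : ℝ → ℝ)
    (hU : ∀ z : ℝ, U z = if 0 ≤ z then U1 z else -(U2 (-z)))
    (hUbar : ∀ x, Ubar x = if x < η then -(U2 r) + x * U1' (η - r) else U1 (x - r)) :
    ∀ x ≥ (0:ℝ), U (x - r) ≤ Ubar x := by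
  intro x hx
  have hmem : η - r ∈ Ici (0 : ℝ) := sub_nonneg.2 hη
  have tangent : ∀ z, 0 ≤ z → z ≤ η - r → U1 z ≤ -(U2 r) + (z + r) * U1' (η - r) := by
    intro z hz hzη
    have h := hU1conc.concaveOn.le_tangent_of_hasDerivWithinAt hz hmem hzη (hU1deriv _ hmem)
    linarith
  rw [hU, hUbar]
  split_ifs with hxr hxη hxη
  · simpa using tangent (x - r) hxr (by linarith)
  · exact le_rfl
  · have hchord := hU2conc.concaveOn.mul_le_mul_of_map_zero hU20 hr
      (show 0 ≤ -(x - r) by linarith) (by linarith)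
    have hslope := tangent 0 le_rfl hmem
    rw [hU10, zero_add] at hslope
    have := mul_nonneg hx hslope
    refine le_of_mul_le_mul_left ?_ hr
    linarith
  · linarith
end

section
/- Let U1, U2 : [0,∞) → ℝ be strictly increasing, strictly concave, continuously differentiable with U1(0) = U2(0) = 0, let r > 0, and let η > r satisfy the tangency equation U1(η − r) + U2(r) − η·U1'(η − r) = 0. Then the non-concavity region is exactly the open interval (0, η): one has U(x − r) = Ū(x, r) for x = 0 and for all x ≥ η, while U(x − r) < Ū(x, r) strictly for all 0 < x < η. -/
open Set Filter Topology

/-- the non-concavity region is exactly the open interval (0, η). -/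
theorem nonconcavity_region (U1 U1' U2 U2' : ℝ → ℝ) (r η : ℝ)
    (hU1mono : StrictMonoOn U1 (Ici 0))
    (hU1conc : StrictConcaveOn ℝ (Ici 0) U1)
    (hU1deriv : ∀ z ∈ Ici (0:ℝ), HasDerivWithinAt U1 (U1' z) (Ici 0) z)
    (hU1derivCont : ContinuousOn U1' (Ici 0))
    (hU10 : U1 0 = 0)
    (hU2mono : StrictMonoOn U2 (Ici 0))
    (hU2conc : StrictConcaveOn ℝ (Ici 0) U2)
    (hU2deriv : ∀ z ∈ Ici (0:ℝ), HasDerivWithinAt U2 (U2' z) (Ici 0) z)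
    (hU2derivCont : ContinuousOn U2' (Ici 0))
    (hU20 : U2 0 = 0)
    (hr : 0 < r) (hη : r < η)
    (htan : U1 (η - r) + U2 r - η * U1' (η - r) = 0)
    (U Ubar : ℝ → ℝ)
    (hU : ∀ z : ℝ, U z = if 0 ≤ z then U1 z else -(U2 (-z)))
    (hUbar : ∀ x, Ubar x = if x < η then -(U2 r) + x * U1' (η - r) else U1 (x - r)) :
    U (0 - r) = Ubar 0 ∧
    (∀ x ≥ η, U (x - r) = Ubar x) ∧
    (∀ x : ℝ, 0 < x → x < η → U (x - r) < Ubar x) := by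
  set m := U1' (η - r)
  have hc : (0 : ℝ) < η - r := sub_pos.mpr hη
  have htangent : ∀ z, 0 ≤ z → z < η - r → U1 z < U1 (η - r) + (z - (η - r)) * m := by
    intro z hz hzc
    have hd : HasDerivAt U1 m (η - r) := (hU1deriv _ hc.le).hasDerivAt (Ici_mem_nhds hc)
    have hs := hU1conc.lt_slope_of_hasDerivAt hz hc.le hzc hd
    rw [slope_def_field, lt_div_iff₀ (sub_pos.mpr hzc)] at hs
    linarith
  have hchord : U2 r < r * m := by
    have h := htangent 0 le_rfl hc
    rw [hU10] at h
    linarith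
  refine ⟨?_, fun x hx => ?_, fun x hx hxη => ?_⟩
  · rw [hU, hUbar, if_neg (by linarith), if_pos (hr.trans hη)]
    simp
  · rw [hU, hUbar, if_pos (by linarith), if_neg (not_lt.mpr hx)]
  · rw [hU, hUbar, if_pos hxη]
    split_ifs with h
    · linarith [htangent (x - r) h (by linarith)]
    · have hxr : x < r := by linarith
      have hconc := hU2conc.2 (mem_Ici.mpr le_rfl) (mem_Ici.mpr hr.le) hr.ne
        (div_pos hx hr) (sub_pos.mpr ((div_lt_one hr).mpr hxr)) (add_sub_cancel _ _)
      have harg : (1 - x / r) * r = r - x := by field_simp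
      simp only [smul_eq_mul, mul_zero, zero_add, hU20, harg] at hconc
      have hscale : x / r * U2 r < x * m := by
        calc x / r * U2 r < x / r * (r * m) := mul_lt_mul_of_pos_left hchord (div_pos hx hr)
          _ = x * m := by field_simp
      rw [neg_sub]
      linarith
end

section
/- For the power S-shaped utility with parameters p ∈ (0,1) and K ≥ 0: let r > 0 and let η > r satisfy (η − r)^p + K r^p = p·η·(η − r)^{p−1}. Then for every y > 0, sup_{x > 0} { U(x − r) − x·y } equals (1 − p)·(y/p)^{p/(p−1)} − r·y if 0 < y ≤ p·(η − r)^{p−1}, and equals −K r^p if y > p·(η − r)^{p−1}. In particular sup_{x > 0} { x^p − x·y } = (1 − p)·(y/p)^{p/(p−1)} for all y > 0, with the supremum attained at x = (y/p)^{1/(p−1)}. -/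
open Set Filter Topology

/-- The graph of `z ↦ z ^ p` lies below its tangent lines when `0 < p < 1`. -/
lemma rpow_le_tangent {p m z : ℝ} (hp : 0 < p) (hp1 : p < 1) (hm : 0 < m) (hz : 0 ≤ z) :
    z ^ p ≤ m ^ p + p * m ^ (p - 1) * (z - m) := by
  have h := rpow_one_add_le_one_add_mul_self (s := z / m - 1)
    (by have := div_nonneg hz hm.le; linarith) hp.le hp1.le
  rw [add_sub_cancel, Real.div_rpow hz hm.le, div_le_iff₀ (Real.rpow_pos_of_pos hm p)] at h
  rw [Real.rpow_sub_one hm.ne']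
  refine h.trans_eq ?_
  field_simp

/-- Scaling down the argument of a concave power scales its value by at least as much. -/
lemma mul_rpow_le_rpow_of_le {p r w : ℝ} (hp1 : p < 1) (hr : 0 < r) (hw : 0 < w) (hwr : w ≤ r) :
    w / r * r ^ p ≤ w ^ p := by
  have h : w / r ≤ (w / r) ^ p := by
    simpa using Real.rpow_le_rpow_of_exponent_ge (div_pos hw hr) ((div_le_one hr).2 hwr) hp1.le
  rw [Real.div_rpow hw.le hr.le, le_div_iff₀ (Real.rpow_pos_of_pos hr p)] at h
  exact h

/-- An upper bound for the S-shaped objective follows from bounds at `x = 0` and on the gains. -/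
lemma sShaped_le {p K r y V : ℝ} (hp : 0 < p) (hp1 : p < 1) (hK : 0 ≤ K) (hr : 0 < r)
    (h0 : -(K * r ^ p) ≤ V) (hgain : ∀ z : ℝ, 0 ≤ z → z ^ p - (z + r) * y ≤ V)
    {x : ℝ} (hx : 0 < x) :
    (if 0 ≤ x - r then (x - r) ^ p else -(K * (-(x - r)) ^ p)) - x * y ≤ V := by
  split_ifs with h
  · simpa using hgain (x - r) h
  · push Not at h
    have hr0 : -(r * y) ≤ V := by simpa [Real.zero_rpow hp.ne'] using hgain 0 le_rfl
    have hpow := mul_le_mul_of_nonneg_left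
      (mul_rpow_le_rpow_of_le (w := -(x - r)) hp1 hr (by linarith) (by linarith)) hK
    have ht : 0 ≤ -(x - r) / r := div_nonneg (by linarith) hr.le
    have ht1 : 0 ≤ 1 - -(x - r) / r := by
      rw [sub_nonneg, div_le_one hr]; linarith
    have hxt : x = (1 - -(x - r) / r) * r := by field_simp; ring
    have hxy : x * y = (1 - -(x - r) / r) * (r * y) := by
      rw [← mul_assoc, ← hxt]
    have e0 := mul_le_mul_of_nonneg_left h0 ht
    have e1 := mul_le_mul_of_nonneg_left hr0 ht1
    linarith

/-- explicit dual utility for the power S-shaped utility. -/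
theorem power_dual_utility (p K r η : ℝ) (hp : 0 < p) (hp1 : p < 1) (hK : 0 ≤ K)
    (hr : 0 < r) (hη : r < η)
    (htan : (η - r) ^ p + K * r ^ p = p * η * (η - r) ^ (p - 1))
    (U : ℝ → ℝ)
    (hU : ∀ z : ℝ, U z = if 0 ≤ z then z ^ p else -(K * (-z) ^ p)) :
    ∀ y > (0:ℝ),
      (y ≤ p * (η - r) ^ (p - 1) →
        sSup ((fun x => U (x - r) - x * y) '' Ioi 0)
          = (1 - p) * (y / p) ^ (p / (p - 1)) - r * y) ∧
      (p * (η - r) ^ (p - 1) < y →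
        sSup ((fun x => U (x - r) - x * y) '' Ioi 0) = -(K * r ^ p)) ∧
      sSup ((fun x : ℝ => x ^ p - x * y) '' Ioi 0)
        = (1 - p) * (y / p) ^ (p / (p - 1)) ∧
      (0:ℝ) < (y / p) ^ (1 / (p - 1)) ∧
      ((y / p) ^ (1 / (p - 1))) ^ p - ((y / p) ^ (1 / (p - 1))) * y
        = (1 - p) * (y / p) ^ (p / (p - 1)) := by
  intro y hy
  have hyp : 0 < y / p := div_pos hy hp
  have hp1' : p - 1 ≠ 0 := by linarith
  have hm : 0 < (y / p) ^ (1 / (p - 1)) := Real.rpow_pos_of_pos hyp _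
  have hmp : ((y / p) ^ (1 / (p - 1))) ^ p = (y / p) ^ (p / (p - 1)) := by
    rw [← Real.rpow_mul hyp.le, one_div_mul_eq_div]
  have hmy : y = p * ((y / p) ^ (1 / (p - 1))) ^ (p - 1) := by
    rw [← Real.rpow_mul hyp.le, one_div_mul_cancel hp1', Real.rpow_one, mul_div_cancel₀ _ hp.ne']
  rw [← hmp]
  set m := (y / p) ^ (1 / (p - 1))
  have hval : m ^ p - m * y = (1 - p) * m ^ p := by
    rw [hmy, Real.rpow_sub_one hm.ne']
    field_simp
  have hmax : ∀ z : ℝ, 0 ≤ z → z ^ p - z * y ≤ (1 - p) * m ^ p := fun z hz => by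
    have h := rpow_le_tangent hp hp1 hm hz
    rw [← hmy] at h
    linarith
  have ha : 0 < η - r := sub_pos.2 hη
  refine ⟨fun hle => ?_, fun hlt => ?_, ?_, hm, hval⟩
  · refine IsGreatest.csSup_eq ⟨⟨m + r, add_pos hm hr, ?_⟩, ?_⟩
    · simp only [hU, add_sub_cancel_right, if_pos hm.le]
      linarith
    · rintro _ ⟨x, hx, rfl⟩
      simp only [hU]
      refine sShaped_le hp hp1 hK hr ?_ (fun z hz => ?_) hx
      · have h1 := hmax _ ha.le
        have h2 := mul_le_mul_of_nonneg_left hle (hr.trans hη).le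
        linarith
      · linarith [hmax z hz]
  · refine csSup_eq_of_forall_le_of_forall_lt_exists_gt (nonempty_Ioi.image _) ?_ fun w hw => ?_
    · rintro _ ⟨x, hx, rfl⟩
      simp only [hU]
      refine sShaped_le hp hp1 hK hr le_rfl (fun z hz => ?_) hx
      have h1 := rpow_le_tangent hp hp1 ha hz
      have h2 := mul_le_mul_of_nonneg_left hlt.le (add_nonneg hz hr.le)
      linarith
    · obtain ⟨x, hx, hxlt⟩ : ∃ x, 0 < x ∧ x < min r ((-(K * r ^ p) - w) / y) :=
        exists_between (lt_min hr (div_pos (sub_pos.2 hw) hy))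
      obtain ⟨hxr, hxw⟩ := lt_min_iff.1 hxlt
      refine ⟨_, ⟨x, hx, rfl⟩, ?_⟩
      simp only [hU, if_neg (not_le.2 (sub_neg.2 hxr))]
      rw [lt_div_iff₀ hy] at hxw
      have h := mul_le_mul_of_nonneg_left (Real.rpow_le_rpow (x := -(x - r)) (y := r)
        (by linarith) (by linarith) hp.le) hK
      linarith
  · refine IsGreatest.csSup_eq ⟨⟨m, hm, hval⟩, ?_⟩
    rintro _ ⟨x, hx, rfl⟩
    exact hmax x (le_of_lt hx)
end

section
/- With the closed-form setup (p, K, ᾱ, θ̄, R̄, ẑ, û, u₀, q, k, G̃ as in the context), for every τ > 0 and y > 0 the expectation of the power dual utility of a lognormal variable equals the closed form: ∫_ℝ Ũ( y · exp( −(ᾱ + θ̄²/2)τ − θ̄·√τ·s ) ) dγ(s) = G̃(τ, y), where γ is the standard Gaussian measure N(0,1) on ℝ. -/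
open Set Filter Topology MeasureTheory ProbabilityTheory

/-- Set integrals against the standard Gaussian, in terms of its density. -/
lemma setIntegral_gaussianReal_zero_one (S : Set ℝ) (hS : MeasurableSet S) (f : ℝ → ℝ) :
    ∫ s in S, f s ∂(gaussianReal 0 1) =
      ∫ s, S.indicator
        (fun s => (Real.sqrt (2 * Real.pi))⁻¹ * Real.exp (-(s ^ 2) / 2) * f s) s := by
  rw [← integral_indicator hS, integral_gaussianReal_eq_integral_smul one_ne_zero]
  congr 1
  ext s
  by_cases hs : s ∈ S <;> simp [hs, gaussianPDFReal]

/-- Truncated exponential moments of the standard Gaussian over an upper half-line. -/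
lemma setIntegral_Ici_exp_gaussianReal (c k : ℝ) :
    ∫ s in Ici k, Real.exp (-c * s) ∂(gaussianReal 0 1) =
      Real.exp (c ^ 2 / 2) *
        ∫ t in Iic (-k - c), (Real.sqrt (2 * Real.pi))⁻¹ * Real.exp (-(t ^ 2) / 2) := by
  rw [setIntegral_gaussianReal_zero_one _ measurableSet_Ici, ← integral_indicator measurableSet_Iic,
    ← integral_sub_left_eq_self _ volume (-c), ← integral_const_mul]
  congr 1
  ext s
  by_cases hs : s ≤ -k - c
  · have h : k ≤ -c - s := by linarith
    simp only [indicator, mem_Ici, mem_Iic, hs, h, if_true]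
    rw [mul_assoc, mul_left_comm (Real.exp (c ^ 2 / 2)), ← Real.exp_add, ← Real.exp_add]
    ring_nf
  · have h : ¬ k ≤ -c - s := by linarith
    simp [indicator, hs, h]

/-- The standard Gaussian mass of a lower half-line. -/
lemma gaussianReal_real_Iio (k : ℝ) :
    (gaussianReal 0 1).real (Iio k) =
      ∫ t in Iic k, (Real.sqrt (2 * Real.pi))⁻¹ * Real.exp (-(t ^ 2) / 2) := by
  have h := setIntegral_gaussianReal_zero_one (Iio k) measurableSet_Iio (fun _ => 1)
  rw [integral_indicator measurableSet_Iio] at h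
  simp only [mul_one, setIntegral_const, smul_eq_mul] at h
  rw [h, integral_Iic_eq_integral_Iio]

/-- closed-form expectation of the power dual utility of a lognormal. -/
theorem dual_value_closed_form
    (p K α θ R zHat uHat u₀ q : ℝ)
    (hp : 0 < p) (hp1 : p < 1) (hK : 0 ≤ K) (hθ : 0 < θ) (hR : 0 < R) (hzHat : R < zHat)
    (htan : (zHat - R) ^ p + K * R ^ p = p * zHat * (zHat - R) ^ (p - 1))
    (huHat : uHat = p * (zHat - R) ^ (p - 1))
    (hu₀ : u₀ = -(K * R ^ p))
    (hq : q = p / (p - 1))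
    (Φ : ℝ → ℝ)
    (hΦ : ∀ x, Φ x = ∫ t in Iic x, (Real.sqrt (2 * Real.pi))⁻¹ * Real.exp (-(t ^ 2) / 2))
    (k : ℝ → ℝ → ℝ)
    (hk : ∀ τ y, k τ y =
      (Real.log y - Real.log uHat - (α + θ ^ 2 / 2) * τ) / (θ * Real.sqrt τ))
    (G : ℝ → ℝ → ℝ)
    (hG : ∀ τ y, G τ y =
      y ^ q * p ^ (-q) * (1 - p) * Real.exp (-q * (α - θ ^ 2 / (2 * (p - 1))) * τ) *
          Φ (-(k τ y) - q * θ * Real.sqrt τ)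
        - R * y * Real.exp (-α * τ) * Φ (-(k τ y) - θ * Real.sqrt τ)
        + u₀ * Φ (k τ y))
    (Utilde : ℝ → ℝ)
    (hUtilde : ∀ y : ℝ, 0 < y →
      Utilde y = if y ≤ uHat then (1 - p) * (y / p) ^ q - R * y else -(K * R ^ p)) :
    ∀ τ > (0:ℝ), ∀ y > (0:ℝ),
      ∫ s, Utilde (y * Real.exp (-(α + θ ^ 2 / 2) * τ - θ * Real.sqrt τ * s))
          ∂(gaussianReal 0 1) = G τ y := by
  intro τ hτ y hy
  have hsτ : 0 < Real.sqrt τ := Real.sqrt_pos.2 hτ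
  have hsq : Real.sqrt τ ^ 2 = τ := Real.sq_sqrt hτ.le
  have hu : 0 < uHat := by
    rw [huHat]
    exact mul_pos hp (Real.rpow_pos_of_pos (sub_pos.2 hzHat) _)
  set κ := k τ y with hκ
  have hthr : ∀ s, y * Real.exp (-(α + θ ^ 2 / 2) * τ - θ * Real.sqrt τ * s) ≤ uHat ↔ κ ≤ s := by
    intro s
    rw [← Real.log_le_log_iff (by positivity) hu, Real.log_mul hy.ne' (Real.exp_ne_zero _),
      Real.log_exp, hκ, hk, div_le_iff₀ (by positivity)]
    constructor <;> intro h <;> linarith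
  set A := (1 - p) * (y ^ q * p ^ (-q)) * Real.exp (-q * (α + θ ^ 2 / 2) * τ) with hA
  set B := R * y * Real.exp (-(α + θ ^ 2 / 2) * τ) with hB
  have hint : ∀ c, Integrable ((Ici κ).indicator fun s => Real.exp (-c * s)) (gaussianReal 0 1) :=
    fun c => (integrable_exp_mul_gaussianReal (-c)).indicator measurableSet_Ici
  have hsplit : (fun s => Utilde (y * Real.exp (-(α + θ ^ 2 / 2) * τ - θ * Real.sqrt τ * s))) =
      fun s => A * (Ici κ).indicator (fun s => Real.exp (-(q * θ * Real.sqrt τ) * s)) s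
        - B * (Ici κ).indicator (fun s => Real.exp (-(θ * Real.sqrt τ) * s)) s
        + (Iio κ).indicator (fun _ => u₀) s := by
    ext s
    rw [hUtilde _ (by positivity)]
    by_cases hs : κ ≤ s
    · have hpow : (y * Real.exp (-(α + θ ^ 2 / 2) * τ - θ * Real.sqrt τ * s) / p) ^ q =
          y ^ q * p ^ (-q) * Real.exp (-q * (α + θ ^ 2 / 2) * τ) *
            Real.exp (-(q * θ * Real.sqrt τ) * s) := by
        rw [Real.div_rpow (by positivity) hp.le, Real.mul_rpow hy.le (Real.exp_pos _).le,
          ← Real.exp_mul, Real.rpow_neg hp.le, mul_assoc (y ^ q * _), ← Real.exp_add,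
          div_eq_mul_inv, mul_right_comm]
        ring_nf
      have hexp : Real.exp (-(α + θ ^ 2 / 2) * τ - θ * Real.sqrt τ * s) =
          Real.exp (-(α + θ ^ 2 / 2) * τ) * Real.exp (-(θ * Real.sqrt τ) * s) := by
        rw [← Real.exp_add]
        ring_nf
      rw [if_pos ((hthr s).2 hs), hpow, hexp, indicator_of_mem (mem_Ici.2 hs),
        indicator_of_mem (mem_Ici.2 hs), indicator_of_notMem (by simpa using hs), hA, hB]
      ring
    · rw [if_neg (mt (hthr s).1 hs), indicator_of_notMem (by simpa using hs),
        indicator_of_notMem (by simpa using hs), indicator_of_mem (by simpa using hs), hu₀]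
      ring
  have hEA : Real.exp (-q * (α + θ ^ 2 / 2) * τ) * Real.exp ((q * θ * Real.sqrt τ) ^ 2 / 2) =
      Real.exp (-q * (α - θ ^ 2 / (2 * (p - 1))) * τ) := by
    have hp' : p - 1 ≠ 0 := by linarith
    rw [← Real.exp_add, mul_pow, hsq, hq]
    congr 1
    field_simp
    ring
  have hEB : Real.exp (-(α + θ ^ 2 / 2) * τ) * Real.exp ((θ * Real.sqrt τ) ^ 2 / 2) =
      Real.exp (-α * τ) := by
    rw [← Real.exp_add, mul_pow, hsq]
    ring_nf
  have hdiff : Integrable (fun s =>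
      A * (Ici κ).indicator (fun s => Real.exp (-(q * θ * Real.sqrt τ) * s)) s
        - B * (Ici κ).indicator (fun s => Real.exp (-(θ * Real.sqrt τ) * s)) s)
      (gaussianReal 0 1) := ((hint _).const_mul A).sub ((hint _).const_mul B)
  rw [hsplit, integral_add hdiff ((integrable_const _).indicator measurableSet_Iio),
    integral_sub ((hint _).const_mul A) ((hint _).const_mul B), integral_const_mul,
    integral_const_mul, integral_indicator measurableSet_Ici, integral_indicator measurableSet_Ici,
    integral_indicator measurableSet_Iio, setIntegral_Ici_exp_gaussianReal,
    setIntegral_Ici_exp_gaussianReal, setIntegral_const, gaussianReal_real_Iio, smul_eq_mul,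
    ← hΦ, ← hΦ, ← hΦ, hG, ← hκ, ← hEA, ← hEB, hA, hB]
  ring
end

section
/- With the closed-form setup (p, K, ᾱ, θ̄, R̄, ẑ, û, u₀, q, k, G̃ as in the context), for every τ > 0 and y > 0 the function y ↦ G̃(τ, y) is differentiable at y with derivative ∂_y G̃(τ, y) = −y^{1/(p−1)} · p^{1/(1−p)} · exp(−q(ᾱ − θ̄²/(2(p−1)))τ) · Φ(−k(τ,y) − q·θ̄√τ) − R̄ · e^{−ᾱτ} · Φ(−k(τ,y) − θ̄√τ); in particular the φ-density terms arising from differentiating the Φ factors cancel exactly, using the tangency equation. -/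
open Set Filter Topology MeasureTheory ProbabilityTheory

theorem integrable_stdGaussian_density :
    Integrable fun t : ℝ => (Real.sqrt (2 * Real.pi))⁻¹ * Real.exp (-(t ^ 2) / 2) := by
  refine Integrable.const_mul ?_ _
  convert integrable_exp_neg_mul_sq (b := 1 / 2) (by norm_num) using 2 with t
  congr 1
  ring

theorem hasDerivAt_integral_Iic {f : ℝ → ℝ} (hf : Integrable f) (hc : Continuous f) (x : ℝ) :
    HasDerivAt (fun x => ∫ t in Iic x, f t) (f x) x := by
  have h : (fun x => ∫ t in Iic x, f t) =
      fun x => (∫ t in (0 : ℝ)..x, f t) + ∫ t in Iic (0 : ℝ), f t := by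
    funext x
    rw [← intervalIntegral.integral_Iic_sub_Iic hf.integrableOn hf.integrableOn]
    ring
  rw [h]
  exact (intervalIntegral.integral_hasDerivAt_right (hc.intervalIntegrable _ _)
    (hc.stronglyMeasurableAtFilter _ _) hc.continuousAt).add_const _

/-- Translating the unnormalised Gaussian density multiplies it by an exponential. -/
theorem exp_neg_sq_div_two_shift (k a : ℝ) :
    Real.exp (-((-k - a) ^ 2) / 2) =
      Real.exp (-(k ^ 2) / 2) * Real.exp (-(k * a) - a ^ 2 / 2) := by
  rw [← Real.exp_add]
  congr 1
  ring

/-- the y-derivative of the closed-form dual value function. -/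
theorem dual_value_deriv
    (p K α θ R zHat uHat u₀ q : ℝ)
    (hp : 0 < p) (hp1 : p < 1) (hK : 0 ≤ K) (hθ : 0 < θ) (hR : 0 < R) (hzHat : R < zHat)
    (htan : (zHat - R) ^ p + K * R ^ p = p * zHat * (zHat - R) ^ (p - 1))
    (huHat : uHat = p * (zHat - R) ^ (p - 1))
    (hu₀ : u₀ = -(K * R ^ p))
    (hq : q = p / (p - 1))
    (Φ : ℝ → ℝ)
    (hΦ : ∀ x, Φ x = ∫ t in Iic x, (Real.sqrt (2 * Real.pi))⁻¹ * Real.exp (-(t ^ 2) / 2))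
    (k : ℝ → ℝ → ℝ)
    (hk : ∀ τ y, k τ y =
      (Real.log y - Real.log uHat - (α + θ ^ 2 / 2) * τ) / (θ * Real.sqrt τ))
    (G : ℝ → ℝ → ℝ)
    (hG : ∀ τ y, G τ y =
      y ^ q * p ^ (-q) * (1 - p) * Real.exp (-q * (α - θ ^ 2 / (2 * (p - 1))) * τ) *
          Φ (-(k τ y) - q * θ * Real.sqrt τ)
        - R * y * Real.exp (-α * τ) * Φ (-(k τ y) - θ * Real.sqrt τ)
        + u₀ * Φ (k τ y)) :
    ∀ τ > (0:ℝ), ∀ y > (0:ℝ),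
      HasDerivAt (fun z => G τ z)
        (-(y ^ (1 / (p - 1)) * p ^ (1 / (1 - p)) *
            Real.exp (-q * (α - θ ^ 2 / (2 * (p - 1))) * τ) *
            Φ (-(k τ y) - q * θ * Real.sqrt τ))
          - R * Real.exp (-α * τ) * Φ (-(k τ y) - θ * Real.sqrt τ)) y := by
  intro τ hτ y hy
  have hs : 0 < Real.sqrt τ := Real.sqrt_pos.2 hτ
  have hss : Real.sqrt τ ^ 2 = τ := Real.sq_sqrt hτ.le
  have hd : 0 < zHat - R := sub_pos.2 hzHat
  have hp1' : p - 1 ≠ 0 := by linarith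
  have hp2 : 1 - p ≠ 0 := by linarith
  have hu : 0 < uHat := by rw [huHat]; positivity
  have hσ : θ * Real.sqrt τ ≠ 0 := by positivity
  have hΦ' : ∀ x, HasDerivAt Φ
      ((Real.sqrt (2 * Real.pi))⁻¹ * Real.exp (-(x ^ 2) / 2)) x := by
    intro x
    rw [funext hΦ]
    exact hasDerivAt_integral_Iic integrable_stdGaussian_density (by fun_prop) x
  have hk' : HasDerivAt (fun z => k τ z) (y⁻¹ / (θ * Real.sqrt τ)) y := by
    rw [funext (hk τ)]
    exact (((Real.hasDerivAt_log hy.ne').sub_const _).sub_const _).div_const _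
  have hkσ : k τ y * (θ * Real.sqrt τ) =
      Real.log y - Real.log uHat - (α + θ ^ 2 / 2) * τ := by
    rw [hk, div_mul_cancel₀ _ hσ]
  have h₁ : HasDerivAt (fun z => Φ (-(k τ z) - q * θ * Real.sqrt τ)) _ y :=
    (hΦ' _).comp y (hk'.neg.sub_const _)
  have h₂ : HasDerivAt (fun z => Φ (-(k τ z) - θ * Real.sqrt τ)) _ y :=
    (hΦ' _).comp y (hk'.neg.sub_const _)
  have h₃ : HasDerivAt (fun z => Φ (k τ z)) _ y := (hΦ' _).comp y hk'
  have hpow : HasDerivAt (fun z : ℝ => z ^ q) (q * y ^ (q - 1)) y :=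
    Real.hasDerivAt_rpow_const (Or.inl hy.ne')
  have hid : HasDerivAt (fun z : ℝ => R * z * Real.exp (-α * τ)) (R * Real.exp (-α * τ)) y := by
    simpa using ((hasDerivAt_id y).const_mul R).mul_const (Real.exp (-α * τ))
  have hmain := (((((hpow.mul_const (p ^ (-q))).mul_const (1 - p)).mul_const
    (Real.exp (-q * (α - θ ^ 2 / (2 * (p - 1))) * τ))).mul h₁).sub (hid.mul h₂)).add
    (h₃.const_mul u₀)
  rw [funext (hG τ)]
  refine hmain.congr_deriv ?_
  have hq1 : q - 1 = 1 / (p - 1) := by rw [hq]; field_simp; ring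
  have hq2 : 1 / (1 - p) = -q + 1 := by rw [hq]; field_simp; ring
  have hqp : q * (1 - p) = -p := by rw [hq]; field_simp; ring
  have hpp : p ^ (1 / (1 - p)) = p ^ (-q) * p := by
    rw [hq2, Real.rpow_add hp, Real.rpow_one]
  have hw : (zHat - R) ^ p = (zHat - R) ^ (p - 1) * (zHat - R) := by
    rw [← Real.rpow_add_one hd.ne']; congr 1; ring
  have hcoef : y ^ q * p ^ (-q) * Real.exp (-q * (α - θ ^ 2 / (2 * (p - 1))) * τ) *
      Real.exp (-(k τ y * (q * θ * Real.sqrt τ)) - (q * θ * Real.sqrt τ) ^ 2 / 2) =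
      (zHat - R) ^ p := by
    have hlu : Real.log uHat = Real.log p + (p - 1) * Real.log (zHat - R) := by
      rw [huHat, Real.log_mul hp.ne' (by positivity), Real.log_rpow hd]
    have hfrac : θ ^ 2 / (2 * (p - 1)) = θ ^ 2 / 2 * (q - 1) := by rw [hq1]; field_simp
    have hqq : q * (p - 1) = p := by linarith
    rw [Real.rpow_def_of_pos hy, Real.rpow_def_of_pos hp, Real.rpow_def_of_pos hd,
      ← Real.exp_add, ← Real.exp_add, ← Real.exp_add, hfrac]
    congr 1
    linear_combination (-q) * hkσ + q * hlu - q ^ 2 * θ ^ 2 / 2 * hss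
      + Real.log (zHat - R) * hqq
  have hcoef' : y * Real.exp (-α * τ) *
      Real.exp (-(k τ y * (θ * Real.sqrt τ)) - (θ * Real.sqrt τ) ^ 2 / 2) = uHat := by
    nth_rewrite 1 [← Real.exp_log hy]
    rw [← Real.exp_add, ← Real.exp_add]
    conv_rhs => rw [← Real.exp_log hu]
    congr 1
    linear_combination -hkσ - θ ^ 2 / 2 * hss
  rw [exp_neg_sq_div_two_shift, exp_neg_sq_div_two_shift, hpp, ← hq1, hu₀]
  have hcancel : -(1 - p) * (zHat - R) ^ p + R * uHat - K * R ^ p = 0 := by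
    rw [huHat]
    linear_combination -htan + p * hw
  set c := (Real.sqrt (2 * Real.pi))⁻¹ * Real.exp (-(k τ y ^ 2) / 2) *
    (y⁻¹ / (θ * Real.sqrt τ))
  linear_combination c * hcancel - c * (1 - p) * hcoef + c * R * hcoef' +
    y ^ (q - 1) * p ^ (-q) * Real.exp (-q * (α - θ ^ 2 / (2 * (p - 1))) * τ) *
      Φ (-(k τ y) - q * θ * Real.sqrt τ) * hqp
end

section
/- With the closed-form setup (p, K, ᾱ, θ̄, R̄, ẑ, û, q, k as in the context), define D(τ, y) = −y^{1/(p−1)} · p^{1/(1−p)} · exp(−q(ᾱ − θ̄²/(2(p−1)))τ) · Φ(−k(τ,y) − q·θ̄√τ) − R̄ · e^{−ᾱτ} · Φ(−k(τ,y) − θ̄√τ). Then for every fixed τ > 0: D(τ, y) → −∞ as y → 0+, and D(τ, y) → 0 as y → ∞. -/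
open Set Filter Topology MeasureTheory ProbabilityTheory

lemma gaussian_integral_Iic_eq_cdf (x : ℝ) :
    ∫ t in Iic x, (Real.sqrt (2 * Real.pi))⁻¹ * Real.exp (-(t ^ 2) / 2) =
      cdf (gaussianReal 0 1) x := by
  rw [cdf_eq_real, measureReal_def, gaussianReal_apply_eq_integral 0 one_ne_zero,
    ENNReal.toReal_ofReal (integral_nonneg fun t => gaussianPDFReal_nonneg 0 1 t)]
  simp [gaussianPDFReal]

lemma tendsto_rpow_nhdsGT_zero_of_neg {r : ℝ} (hr : r < 0) :
    Tendsto (fun y : ℝ => y ^ r) (𝓝[>] 0) atTop := by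
  have h := (tendsto_rpow_atTop (neg_pos.2 hr)).comp (tendsto_inv_nhdsGT_zero (𝕜 := ℝ))
  refine h.congr' ?_
  filter_upwards [self_mem_nhdsWithin] with y hy
  rw [Function.comp_apply, Real.inv_rpow (le_of_lt hy), Real.rpow_neg (le_of_lt hy), inv_inv]

/-- boundary behaviour of the derivative of the dual value function:
D(τ, y) → −∞ as y → 0+ and D(τ, y) → 0 as y → ∞. -/
theorem dual_value_deriv_limits
    (p K α θ R zHat uHat u₀ q : ℝ)
    (hp : 0 < p) (hp1 : p < 1) (hK : 0 ≤ K) (hθ : 0 < θ) (hR : 0 < R) (hzHat : R < zHat)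
    (htan : (zHat - R) ^ p + K * R ^ p = p * zHat * (zHat - R) ^ (p - 1))
    (huHat : uHat = p * (zHat - R) ^ (p - 1))
    (hu₀ : u₀ = -(K * R ^ p))
    (hq : q = p / (p - 1))
    (Φ : ℝ → ℝ)
    (hΦ : ∀ x, Φ x = ∫ t in Iic x, (Real.sqrt (2 * Real.pi))⁻¹ * Real.exp (-(t ^ 2) / 2))
    (k : ℝ → ℝ → ℝ)
    (hk : ∀ τ y, k τ y =
      (Real.log y - Real.log uHat - (α + θ ^ 2 / 2) * τ) / (θ * Real.sqrt τ))
    (D : ℝ → ℝ → ℝ)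
    (hD : ∀ τ y, D τ y =
      -(y ^ (1 / (p - 1)) * p ^ (1 / (1 - p)) *
          Real.exp (-q * (α - θ ^ 2 / (2 * (p - 1))) * τ) *
          Φ (-(k τ y) - q * θ * Real.sqrt τ))
        - R * Real.exp (-α * τ) * Φ (-(k τ y) - θ * Real.sqrt τ)) :
    ∀ τ > (0:ℝ),
      Tendsto (fun y => D τ y) (𝓝[>] 0) atBot ∧
      Tendsto (fun y => D τ y) atTop (𝓝 0) := by
  intro τ hτ
  have hs : 0 < θ * Real.sqrt τ := mul_pos hθ (Real.sqrt_pos.2 hτ)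
  have hr : 1 / (p - 1) < 0 := one_div_neg.2 (by linarith)
  have hC : 0 < p ^ (1 / (1 - p)) * Real.exp (-q * (α - θ ^ 2 / (2 * (p - 1))) * τ) := by positivity
  have hΦcdf : Φ = cdf (gaussianReal 0 1) :=
    funext fun x => (hΦ x).trans (gaussian_integral_Iic_eq_cdf x)
  have hbot : Tendsto Φ atBot (𝓝 0) := hΦcdf ▸ tendsto_cdf_atBot _
  have htop : Tendsto Φ atTop (𝓝 1) := hΦcdf ▸ tendsto_cdf_atTop _
  have hk0 : Tendsto (k τ) (𝓝[>] 0) atBot := by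
    simp only [funext (hk τ), sub_eq_add_neg]
    exact ((tendsto_atBot_add_const_right _ _ <| tendsto_atBot_add_const_right _ _
      Real.tendsto_log_nhdsGT_zero)).atBot_div_const hs
  have hkt : Tendsto (k τ) atTop atTop := by
    simp only [funext (hk τ), sub_eq_add_neg]
    exact ((tendsto_atTop_add_const_right _ _ <| tendsto_atTop_add_const_right _ _
      Real.tendsto_log_atTop)).atTop_div_const hs
  have hΦ0 (c : ℝ) : Tendsto (fun y => Φ (-(k τ y) - c)) (𝓝[>] 0) (𝓝 1) := by
    simp only [sub_eq_add_neg]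
    exact htop.comp (tendsto_atTop_add_const_right _ _ (tendsto_neg_atBot_atTop.comp hk0))
  have hΦt (c : ℝ) : Tendsto (fun y => Φ (-(k τ y) - c)) atTop (𝓝 0) := by
    simp only [sub_eq_add_neg]
    exact hbot.comp (tendsto_atBot_add_const_right _ _ (tendsto_neg_atTop_atBot.comp hkt))
  simp only [hD, mul_assoc (_ ^ (1 / (p - 1)) : ℝ) (p ^ (1 / (1 - p)))]
  constructor
  · have hmain := ((tendsto_rpow_nhdsGT_zero_of_neg hr).atTop_mul_const hC).atTop_mul_pos
      one_pos (hΦ0 (q * θ * Real.sqrt τ))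
    have hrest := ((hΦ0 (θ * Real.sqrt τ)).const_mul (R * Real.exp (-α * τ))).neg
    simpa only [Function.comp_def, sub_eq_add_neg] using
      (tendsto_neg_atTop_atBot.comp hmain).atBot_add hrest
  · have hpow : Tendsto (fun y : ℝ => y ^ (1 / (p - 1))) atTop (𝓝 0) := by
      simpa using tendsto_rpow_neg_atTop (neg_pos.2 hr)
    simpa using ((hpow.mul_const _).mul (hΦt (q * θ * Real.sqrt τ))).neg.sub
      ((hΦt (θ * Real.sqrt τ)).const_mul (R * Real.exp (-α * τ)))
end

section
/- With the closed-form setup (p, K, ᾱ, θ̄, R̄, ẑ, û, q, k as in the context), define Z*(τ, y) = y^{1/(p−1)} · p^{1/(1−p)} · exp(−q(ᾱ − θ̄²/(2(p−1)))τ) · Φ(−k(τ,y) − q·θ̄√τ) + R̄ · e^{−ᾱτ} · Φ(−k(τ,y) − θ̄√τ). Then as τ → 0+: (a) if y > û then Z*(τ, y) → 0; (b) if 0 < y < û then Z*(τ, y) → p^{1/(1−p)}·y^{1/(p−1)} + R̄, and this limit is strictly greater than ẑ; (c) if y = û then Z*(τ, y) → ẑ/2. In particular, for every y ≠ û the limit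 of Z*(τ, y) as τ → 0+ lies in the set {0} ∪ [ẑ, ∞). -/
open Set Filter Topology MeasureTheory ProbabilityTheory

/-- The standard normal distribution function, written as an integral of its density, is continuous,
has limits `0` and `1` at `-∞` and `∞`, and takes the value `1 / 2` at the origin. -/
theorem stdNormal_integral_properties (Φ : ℝ → ℝ)
    (hΦ : ∀ x, Φ x = ∫ t in Iic x, (Real.sqrt (2 * Real.pi))⁻¹ * Real.exp (-(t ^ 2) / 2)) :
    Continuous Φ ∧ Tendsto Φ atTop (𝓝 1) ∧ Tendsto Φ atBot (𝓝 0) ∧ Φ 0 = 1 / 2 := by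
  set f : ℝ → ℝ := fun t => (Real.sqrt (2 * Real.pi))⁻¹ * Real.exp (-(t ^ 2) / 2) with hf
  have hfe : f = fun t => (Real.sqrt (2 * Real.pi))⁻¹ * Real.exp (-(1 / 2) * t ^ 2) := by
    funext t
    simp only [hf]
    congr 2
    ring
  have hint : Integrable f := by
    rw [hfe]
    exact (integrable_exp_neg_mul_sq (by norm_num)).const_mul _
  have hIoi : ∫ t in Ioi (0 : ℝ), f t = 1 / 2 := by
    rw [hfe, integral_const_mul, integral_gaussian_Ioi]
    have h2 : Real.pi / (1 / 2) = 2 * Real.pi := by ring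
    have h3 : Real.sqrt (2 * Real.pi) ≠ 0 := by positivity
    rw [h2]
    field_simp
  have hzero : Φ 0 = 1 / 2 := by
    rw [hΦ, ← hIoi]
    have h := integral_comp_neg_Iic (0 : ℝ) f
    rw [neg_zero] at h
    rw [← h]
    simp [hf]
  have hform : Φ = fun x => 1 / 2 + ∫ t in (0 : ℝ)..x, f t := by
    funext x
    rw [← intervalIntegral.integral_Iic_sub_Iic hint.integrableOn hint.integrableOn,
      ← hΦ x, ← hΦ 0, hzero]
    ring
  refine ⟨?_, ?_, ?_, hzero⟩
  · rw [hform]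
    exact continuous_const.add
      (intervalIntegral.continuous_primitive (fun _ _ => hint.intervalIntegrable) 0)
  · have h := intervalIntegral_tendsto_integral_Ioi 0 hint.integrableOn tendsto_id
    rw [hIoi] at h
    rw [hform]
    have h' := h.const_add (1 / 2)
    rwa [add_halves] at h'
  · have h := intervalIntegral_tendsto_integral_Iic 0 hint.integrableOn tendsto_id
    rw [← hΦ 0, hzero] at h
    have h' := h.const_sub (1 / 2)
    rw [sub_self] at h'
    rw [hform]
    refine h'.congr fun x => ?_
    rw [intervalIntegral.integral_symm]
    simp [sub_eq_add_neg]

theorem tendsto_sqrt_nhdsGT_zero :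
    Tendsto Real.sqrt (𝓝[>] 0) (𝓝[>] 0) := by
  refine tendsto_nhdsWithin_iff.2 ⟨?_, ?_⟩
  · simpa using (Real.continuous_sqrt.tendsto 0).mono_left nhdsWithin_le_nhds
  · filter_upwards [self_mem_nhdsWithin] with t ht
    exact Real.sqrt_pos.2 ht

theorem neg_normalized_drift_eq {θ τ : ℝ} (hθ : θ ≠ 0) (hτ : 0 < τ) (A B c : ℝ) :
    -(A / θ) * (Real.sqrt τ)⁻¹ + (B / θ - c) * Real.sqrt τ =
      -((A - B * τ) / (θ * Real.sqrt τ)) - c * Real.sqrt τ := by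
  have hs : Real.sqrt τ ≠ 0 := (Real.sqrt_pos.2 hτ).ne'
  have h2 : Real.sqrt τ ^ 2 = τ := Real.sq_sqrt hτ.le
  field_simp
  rw [h2]
  ring

theorem tendsto_neg_normalized_drift_atBot {θ A : ℝ} (hθ : 0 < θ) (hA : 0 < A) (B c : ℝ) :
    Tendsto (fun τ => -((A - B * τ) / (θ * Real.sqrt τ)) - c * Real.sqrt τ) (𝓝[>] 0) atBot := by
  have hs := tendsto_sqrt_nhdsGT_zero
  have h1 := (tendsto_inv_nhdsGT_zero.comp hs).const_mul_atTop_of_neg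
    (neg_lt_zero.2 (div_pos hA hθ))
  have h2 := (hs.mono_right nhdsWithin_le_nhds).const_mul (B / θ - c)
  refine (h1.atBot_add h2).congr' ?_
  filter_upwards [self_mem_nhdsWithin] with τ hτ
  exact neg_normalized_drift_eq hθ.ne' hτ A B c

theorem tendsto_neg_normalized_drift_atTop {θ A : ℝ} (hθ : 0 < θ) (hA : A < 0) (B c : ℝ) :
    Tendsto (fun τ => -((A - B * τ) / (θ * Real.sqrt τ)) - c * Real.sqrt τ) (𝓝[>] 0) atTop := by
  refine (tendsto_neg_atBot_atTop.comp
    (tendsto_neg_normalized_drift_atBot hθ (neg_pos.2 hA) (-B) (-c))).congr fun τ => ?_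
  simp only [Function.comp_apply]
  ring

theorem tendsto_neg_normalized_drift_zero {θ : ℝ} (hθ : 0 < θ) (B c : ℝ) :
    Tendsto (fun τ => -((0 - B * τ) / (θ * Real.sqrt τ)) - c * Real.sqrt τ) (𝓝[>] 0) (𝓝 0) := by
  have h2 := (tendsto_sqrt_nhdsGT_zero.mono_right nhdsWithin_le_nhds).const_mul (B / θ - c)
  rw [mul_zero] at h2
  refine h2.congr' ?_
  filter_upwards [self_mem_nhdsWithin] with τ hτ
  rw [← neg_normalized_drift_eq hθ.ne' hτ 0 B c]
  ring

/-- terminal-time limits of the optimal wealth map Z*(τ, y):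
0 above the threshold, at least zHat below it, zHat/2 at the kink, so away from
the kink the limit lies in {0} ∪ [zHat, ∞). -/
theorem optimal_wealth_terminal_limits
    (p K α θ R zHat uHat u₀ q : ℝ)
    (hp : 0 < p) (hp1 : p < 1) (hK : 0 ≤ K) (hθ : 0 < θ) (hR : 0 < R) (hzHat : R < zHat)
    (htan : (zHat - R) ^ p + K * R ^ p = p * zHat * (zHat - R) ^ (p - 1))
    (huHat : uHat = p * (zHat - R) ^ (p - 1))
    (hu₀ : u₀ = -(K * R ^ p))
    (hq : q = p / (p - 1))
    (Φ : ℝ → ℝ)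
    (hΦ : ∀ x, Φ x = ∫ t in Iic x, (Real.sqrt (2 * Real.pi))⁻¹ * Real.exp (-(t ^ 2) / 2))
    (k : ℝ → ℝ → ℝ)
    (hk : ∀ τ y, k τ y =
      (Real.log y - Real.log uHat - (α + θ ^ 2 / 2) * τ) / (θ * Real.sqrt τ))
    (Z : ℝ → ℝ → ℝ)
    (hZ : ∀ τ y, Z τ y =
      y ^ (1 / (p - 1)) * p ^ (1 / (1 - p)) *
          Real.exp (-q * (α - θ ^ 2 / (2 * (p - 1))) * τ) *
          Φ (-(k τ y) - q * θ * Real.sqrt τ)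
        + R * Real.exp (-α * τ) * Φ (-(k τ y) - θ * Real.sqrt τ)) :
    (∀ y : ℝ, uHat < y → Tendsto (fun τ => Z τ y) (𝓝[>] 0) (𝓝 0)) ∧
    (∀ y : ℝ, 0 < y → y < uHat →
      Tendsto (fun τ => Z τ y) (𝓝[>] 0)
          (𝓝 (p ^ (1 / (1 - p)) * y ^ (1 / (p - 1)) + R)) ∧
        zHat < p ^ (1 / (1 - p)) * y ^ (1 / (p - 1)) + R) ∧
    Tendsto (fun τ => Z τ uHat) (𝓝[>] 0) (𝓝 (zHat / 2)) ∧
    (∀ y : ℝ, 0 < y → y ≠ uHat →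
      ∃ L, Tendsto (fun τ => Z τ y) (𝓝[>] 0) (𝓝 L) ∧ (L = 0 ∨ zHat ≤ L)) := by
  obtain ⟨hcont, htop, hbot, hhalf⟩ := stdNormal_integral_properties Φ hΦ
  have hzR : 0 < zHat - R := sub_pos.2 hzHat
  have hu : 0 < uHat := by rw [huHat]; positivity
  have hp0 : p - 1 < 0 := by linarith
  have hexp (a : ℝ) : Tendsto (fun τ : ℝ => Real.exp (a * τ)) (𝓝[>] 0) (𝓝 1) := by
    have h : Continuous fun τ : ℝ => Real.exp (a * τ) := by fun_prop
    simpa using (h.tendsto 0).mono_left nhdsWithin_le_nhds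
  have hlim (y l : ℝ)
      (hΦl : ∀ c, Tendsto (fun τ => Φ (-(k τ y) - c * Real.sqrt τ)) (𝓝[>] 0) (𝓝 l)) :
      Tendsto (fun τ => Z τ y) (𝓝[>] 0)
        (𝓝 ((p ^ (1 / (1 - p)) * y ^ (1 / (p - 1)) + R) * l)) := by
    simp only [hZ]
    convert (((hexp (-q * (α - θ ^ 2 / (2 * (p - 1))))).const_mul
      (y ^ (1 / (p - 1)) * p ^ (1 / (1 - p)))).mul (hΦl (q * θ))).add
      (((hexp (-α)).const_mul R).mul (hΦl θ)) using 2
    ring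
  have hinverse : p ^ (1 / (1 - p)) * uHat ^ (1 / (p - 1)) = zHat - R := by
    have he : 1 / (1 - p) + 1 / (p - 1) = 0 := by
      rw [← neg_sub p 1, div_neg, neg_add_cancel]
    rw [huHat, Real.mul_rpow hp.le (by positivity), ← Real.rpow_mul hzR.le,
      mul_one_div_cancel hp0.ne, Real.rpow_one, ← mul_assoc, ← Real.rpow_add hp, he,
      Real.rpow_zero, one_mul]
  have habove (y : ℝ) (hy : uHat < y) : Tendsto (fun τ => Z τ y) (𝓝[>] 0) (𝓝 0) := by
    have hlog : 0 < Real.log y - Real.log uHat := sub_pos.2 (Real.log_lt_log hu hy)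
    simpa using hlim y 0 fun c => by
      simpa only [hk, Function.comp_def]
        using hbot.comp (tendsto_neg_normalized_drift_atBot hθ hlog _ c)
  have hbelow (y : ℝ) (hy0 : 0 < y) (hy : y < uHat) :
      Tendsto (fun τ => Z τ y) (𝓝[>] 0) (𝓝 (p ^ (1 / (1 - p)) * y ^ (1 / (p - 1)) + R)) ∧
        zHat < p ^ (1 / (1 - p)) * y ^ (1 / (p - 1)) + R := by
    have hlog : Real.log y - Real.log uHat < 0 := sub_neg.2 (Real.log_lt_log hy0 hy)
    constructor
    · simpa using hlim y 1 fun c => by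
        simpa only [hk, Function.comp_def]
          using htop.comp (tendsto_neg_normalized_drift_atTop hθ hlog _ c)
    · have hpow : uHat ^ (1 / (p - 1)) < y ^ (1 / (p - 1)) :=
        Real.rpow_lt_rpow_of_neg hy0 hy (one_div_neg.2 hp0)
      have := mul_lt_mul_of_pos_left hpow (Real.rpow_pos_of_pos hp (1 / (1 - p)))
      linarith
  refine ⟨habove, hbelow, ?_, fun y hy0 hne => ?_⟩
  · have hΦ0 : Tendsto Φ (𝓝 0) (𝓝 (1 / 2)) := hhalf ▸ hcont.tendsto 0
    convert hlim uHat (1 / 2) fun c => by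
      simpa only [hk, sub_self, Function.comp_def]
        using hΦ0.comp (tendsto_neg_normalized_drift_zero hθ _ c) using 2
    rw [hinverse]
    ring
  · rcases lt_or_gt_of_ne hne with h | h
    · exact ⟨_, (hbelow y hy0 h).1, Or.inr (hbelow y hy0 h).2.le⟩
    · exact ⟨0, habove y h, Or.inl rfl⟩
end

section
/- Let p ∈ (0,1), K ≥ 0, and let η₁ > 1 satisfy (η₁ − 1)^p + K = p·η₁·(η₁ − 1)^{p−1}. Fix constants α, a ∈ ℝ, θ > 0, b ≥ 0, T > 0, r₀ > 0 with θ + b(p − 1) ≠ 0. Define ζ(s) = exp(−(α + θ²/2)T − θ√T·s) and R(s) = r₀·exp((a − b²/2)T + b√T·s) for s ∈ ℝ, and D(y, r) = (y/p)^{1/(p−1)} + r if 0 < y < p·((η₁ − 1)r)^{p−1} and D(y, r) = 0 otherwise. Define the budget function ψ(λ) = ∫_ℝ ζ(s)·D(λ·ζ(s), R(s)) dγ(s) for λ > 0, where γ is the standard Gaussian measure N(0,1) on ℝ. Then ψ(λ) is finite for every λ > 0, ψ is continuous and strictly decreasing on (0,∞), ψ(λ) → ∞ as λ → 0+, ψ(λ)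 → 0 as λ → ∞, and consequently for every x₀ > 0 there exists a unique λ* > 0 with ψ(λ*) = x₀. -/
open Set Filter Topology MeasureTheory ProbabilityTheory

section Threshold

variable {Ω : Type*} {c : ℝ} {A E G : Ω → ℝ}

/-- A decreasing power profile in `l`, killed once `l` reaches the threshold `G s`. -/
noncomputable def thresholdPower (c : ℝ) (A E G : Ω → ℝ) (l : ℝ) (s : Ω) : ℝ :=
  if l < G s then l ^ c * A s + E s else 0

lemma thresholdPower_nonneg (hA : ∀ s, 0 < A s) (hE : ∀ s, 0 < E s) {l : ℝ} (hl : 0 < l)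
    (s : Ω) : 0 ≤ thresholdPower c A E G l s := by
  have := hA s
  have := hE s
  unfold thresholdPower
  split_ifs <;> positivity

lemma norm_thresholdPower_le (hc : c ≤ 0) (hA : ∀ s, 0 < A s) (hE : ∀ s, 0 < E s)
    {l₀ l : ℝ} (hl₀ : 0 < l₀) (hl : l₀ ≤ l) (s : Ω) :
    ‖thresholdPower c A E G l s‖ ≤ l₀ ^ c * A s + E s := by
  rw [Real.norm_of_nonneg (thresholdPower_nonneg hA hE (hl₀.trans_le hl) s)]
  have hAs := hA s
  have hEs := hE s
  unfold thresholdPower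
  split_ifs
  · have := Real.rpow_le_rpow_of_nonpos hl₀ hl hc
    gcongr
  · positivity

lemma thresholdPower_anti (hc : c ≤ 0) (hA : ∀ s, 0 < A s) (hE : ∀ s, 0 < E s)
    {l₁ l₂ : ℝ} (hl₁ : 0 < l₁) (hl : l₁ ≤ l₂) (s : Ω) :
    thresholdPower c A E G l₂ s ≤ thresholdPower c A E G l₁ s := by
  by_cases h : l₂ < G s
  · have := (hA s).le
    have := Real.rpow_le_rpow_of_nonpos hl₁ hl hc
    simp only [thresholdPower, h, hl.trans_lt h, if_true]
    gcongr
  · rw [thresholdPower, if_neg h]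
    exact thresholdPower_nonneg hA hE hl₁ s

lemma continuousAt_thresholdPower {l : ℝ} (hl : 0 < l) {s : Ω} (h : G s ≠ l) :
    ContinuousAt (fun l => thresholdPower c A E G l s) l := by
  rcases h.lt_or_gt with h | h
  · refine continuousAt_const.congr (f := fun _ => (0 : ℝ)) ?_
    filter_upwards [lt_mem_nhds h] with x hx
    simp [thresholdPower, hx.not_gt]
  · have : ContinuousAt (fun l : ℝ => l ^ c * A s + E s) l :=
      ((Real.continuousAt_rpow_const l c (Or.inl hl.ne')).mul_const _).add_const _
    refine this.congr ?_
    filter_upwards [gt_mem_nhds h] with x hx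
    simp [thresholdPower, hx]

variable [MeasurableSpace Ω] {μ : Measure Ω}

lemma measurable_thresholdPower (hA : Measurable A) (hE : Measurable E) (hG : Measurable G)
    (l : ℝ) : Measurable (thresholdPower c A E G l) :=
  Measurable.ite (measurableSet_lt measurable_const hG) ((hA.const_mul _).add hE)
    measurable_const

lemma integrable_thresholdPower (hc : c ≤ 0) (hA : ∀ s, 0 < A s) (hE : ∀ s, 0 < E s)
    (hAm : Measurable A) (hEm : Measurable E) (hGm : Measurable G)
    (hAi : Integrable A μ) (hEi : Integrable E μ) {l : ℝ} (hl : 0 < l) :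
    Integrable (thresholdPower c A E G l) μ :=
  ((hAi.const_mul (l ^ c)).add hEi).mono'
    (measurable_thresholdPower hAm hEm hGm l).aestronglyMeasurable
    (ae_of_all _ fun s => norm_thresholdPower_le hc hA hE hl le_rfl s)

lemma continuousOn_integral_thresholdPower (hc : c ≤ 0) (hA : ∀ s, 0 < A s)
    (hE : ∀ s, 0 < E s) (hAm : Measurable A) (hEm : Measurable E) (hGm : Measurable G)
    (hAi : Integrable A μ) (hEi : Integrable E μ) (hG : ∀ l, ∀ᵐ s ∂μ, G s ≠ l) :
    ContinuousOn (fun l => ∫ s, thresholdPower c A E G l s ∂μ) (Ioi 0) := by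
  intro l (hl : 0 < l)
  refine ContinuousAt.continuousWithinAt ?_
  refine continuousAt_of_dominated (bound := fun s => (l / 2) ^ c * A s + E s)
    (Eventually.of_forall fun x =>
      (measurable_thresholdPower hAm hEm hGm x).aestronglyMeasurable)
    ?_ ((hAi.const_mul _).add hEi) ?_
  · filter_upwards [lt_mem_nhds (half_lt_self hl)] with x hx
    exact ae_of_all _ fun s => norm_thresholdPower_le hc hA hE (half_pos hl) hx.le s
  · filter_upwards [hG l] with s hs
    exact continuousAt_thresholdPower hl hs

lemma strictAntiOn_integral_thresholdPower (hc : c < 0) (hA : ∀ s, 0 < A s)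
    (hE : ∀ s, 0 < E s) (hAm : Measurable A) (hEm : Measurable E) (hGm : Measurable G)
    (hAi : Integrable A μ) (hEi : Integrable E μ) (hG : ∀ l, 0 < μ {s | l < G s}) :
    StrictAntiOn (fun l => ∫ s, thresholdPower c A E G l s ∂μ) (Ioi 0) := by
  intro l₁ (hl₁ : 0 < l₁) l₂ (hl₂ : 0 < l₂) hl
  have h₁ := integrable_thresholdPower (μ := μ) hc.le hA hE hAm hEm hGm hAi hEi hl₁
  have h₂ := integrable_thresholdPower (μ := μ) hc.le hA hE hAm hEm hGm hAi hEi hl₂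
  rw [← sub_pos]
  simp only
  rw [← integral_sub h₁ h₂, integral_pos_iff_support_of_nonneg
    (fun s => sub_nonneg.2 (thresholdPower_anti hc.le hA hE hl₁ hl.le s)) (h₁.sub h₂)]
  refine (hG l₁).trans_le (measure_mono fun s (hs : l₁ < G s) => ?_)
  have hAs := hA s
  have hEs := hE s
  have hpow := Real.rpow_lt_rpow_of_neg hl₁ hl hc
  refine (sub_pos.2 ?_).ne'
  by_cases h : l₂ < G s
  · simp only [thresholdPower, h, hs, if_true]
    gcongr
  · rw [thresholdPower, if_neg h, thresholdPower, if_pos hs]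
    positivity

lemma tendsto_integral_thresholdPower_nhdsGT_zero (hc : c < 0) (hA : ∀ s, 0 < A s)
    (hE : ∀ s, 0 < E s) (hAm : Measurable A) (hEm : Measurable E) (hGm : Measurable G)
    (hAi : Integrable A μ) (hEi : Integrable E μ) (hG : ∀ l, 0 < μ {s | l < G s}) :
    Tendsto (fun l => ∫ s, thresholdPower c A E G l s ∂μ) (𝓝[>] 0) atTop := by
  have hmeas : MeasurableSet {s | 1 < G s} := measurableSet_lt measurable_const hGm
  have hpos : 0 < ∫ s in {s | 1 < G s}, A s ∂μ := by
    rw [setIntegral_pos_iff_support_of_nonneg_ae (ae_of_all _ fun s => (hA s).le)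
      hAi.integrableOn, (Function.support_eq_univ fun s => (hA s).ne'), univ_inter]
    exact hG 1
  refine tendsto_atTop_mono' _ ?_ ((tendsto_rpow_neg_nhdsGT_zero hc).atTop_mul_const hpos)
  filter_upwards [Ioo_mem_nhdsGT (zero_lt_one' ℝ)] with l ⟨hl, hl1⟩
  rw [← integral_const_mul, ← integral_indicator hmeas]
  refine integral_mono ((hAi.const_mul _).indicator hmeas)
    (integrable_thresholdPower hc.le hA hE hAm hEm hGm hAi hEi hl) fun s => ?_
  by_cases h : 1 < G s
  · simp [indicator, thresholdPower, h, hl1.trans h, (hE s).le]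
  · simpa [indicator, h] using thresholdPower_nonneg hA hE hl s

lemma tendsto_integral_thresholdPower_atTop (hc : c ≤ 0) (hA : ∀ s, 0 < A s)
    (hE : ∀ s, 0 < E s) (hAm : Measurable A) (hEm : Measurable E) (hGm : Measurable G)
    (hAi : Integrable A μ) (hEi : Integrable E μ) :
    Tendsto (fun l => ∫ s, thresholdPower c A E G l s ∂μ) atTop (𝓝 0) := by
  rw [← integral_zero Ω ℝ (μ := μ)]
  refine tendsto_integral_filter_of_dominated_convergence
    (fun s => (1 : ℝ) ^ c * A s + E s)
    (Eventually.of_forall fun x =>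
      (measurable_thresholdPower hAm hEm hGm x).aestronglyMeasurable)
    ?_ ((hAi.const_mul _).add hEi) (ae_of_all _ fun s => ?_)
  · filter_upwards [eventually_ge_atTop 1] with l hl
    exact ae_of_all _ fun s => norm_thresholdPower_le hc hA hE one_pos hl s
  · refine tendsto_const_nhds.congr' ?_
    filter_upwards [eventually_ge_atTop (G s)] with l hl
    simp [thresholdPower, hl.not_gt]

end Threshold

lemma existsUnique_of_strictAntiOn_Ioi {f : ℝ → ℝ} (hf : ContinuousOn f (Ioi 0))
    (hanti : StrictAntiOn f (Ioi 0)) (h0 : Tendsto f (𝓝[>] 0) atTop)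
    (htop : Tendsto f atTop (𝓝 0)) {x : ℝ} (hx : 0 < x) : ∃! l : ℝ, l > 0 ∧ f l = x := by
  obtain ⟨l₁, hl₁x, hl₁⟩ := ((h0.eventually_gt_atTop x).and self_mem_nhdsWithin).exists
  obtain ⟨l₂, hl₂x, hl₂⟩ :=
    ((htop.eventually (gt_mem_nhds hx)).and (eventually_gt_atTop 0)).exists
  obtain ⟨l, hl, hlx⟩ := isPreconnected_Ioi.intermediate_value (s := Ioi (0 : ℝ))
    (mem_Ioi.2 hl₂) hl₁ hf ⟨hl₂x.le, hl₁x.le⟩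
  exact ⟨l, ⟨hl, hlx⟩, fun l' h => hanti.injOn h.1 hl (h.2.trans hlx.symm)⟩

lemma integrable_exp_affine_gaussianReal (u v : ℝ) :
    Integrable (fun s => Real.exp (u + v * s)) (gaussianReal 0 1) := by
  simp only [Real.exp_add]
  exact (integrable_exp_mul_gaussianReal v).const_mul _

lemma gaussianReal_exp_affine_gt_pos (u : ℝ) {v : ℝ} (hv : v ≠ 0) (l : ℝ) :
    0 < gaussianReal 0 1 {s | l < Real.exp (u + v * s)} := by
  have hopen : IsOpen {s : ℝ | l < Real.exp (u + v * s)} :=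
    isOpen_lt continuous_const (by fun_prop)
  have hne : {s : ℝ | l < Real.exp (u + v * s)}.Nonempty := by
    refine ⟨(l - u) / v, ?_⟩
    have : u + v * ((l - u) / v) = l := by field_simp; ring
    rw [mem_ofPred_eq, this]
    linarith [Real.add_one_le_exp l]
  refine pos_iff_ne_zero.2 fun h => (hopen.measure_pos volume hne).ne' ?_
  exact gaussianReal_absolutelyContinuous' 0 one_ne_zero h

lemma gaussianReal_ae_exp_affine_ne (u : ℝ) {v : ℝ} (hv : v ≠ 0) (l : ℝ) :
    ∀ᵐ s ∂gaussianReal 0 1, Real.exp (u + v * s) ≠ l := by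
  have := nullSingletonClass_gaussianReal (μ := 0) (v := 1) one_ne_zero
  have hsub : {s : ℝ | Real.exp (u + v * s) = l}.Subsingleton := fun x hx y hy => by
    have := Real.exp_injective (hx.trans hy.symm)
    exact mul_left_cancel₀ hv (by linarith)
  exact measure_eq_zero_iff_ae_notMem.1 (hsub.measure_zero _)

lemma mul_ite_rpow_add_eq {p k l z r : ℝ} (hp : 0 < p) (hl : 0 < l)
    (hz : 0 < z) :
    z * (if 0 < l * z ∧ l * z < p * (k * r) ^ (p - 1)
        then (l * z / p) ^ (1 / (p - 1)) + r else 0) =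
      if l < p * (k * r) ^ (p - 1) / z
        then l ^ (1 / (p - 1)) * (z * (z / p) ^ (1 / (p - 1))) + z * r else 0 := by
  have h : 0 < l * z := mul_pos hl hz
  simp only [h, true_and, lt_div_iff₀ hz]
  split_ifs
  · rw [mul_div_assoc, Real.mul_rpow hl.le (by positivity)]
    ring
  · simp

/-- the budget function ψ is finite, continuous, strictly decreasing
on (0,∞), blows up at 0+, vanishes at ∞, and hence matches any initial wealth
x₀ > 0 at a unique multiplier λ* > 0. -/
theorem budget_function_properties
    (p K η₁ α a θ b T r₀ : ℝ)
    (hp : 0 < p) (hp1 : p < 1) (hK : 0 ≤ K)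
    (hη₁ : 1 < η₁)
    (htan : (η₁ - 1) ^ p + K = p * η₁ * (η₁ - 1) ^ (p - 1))
    (hθ : 0 < θ) (hb : 0 ≤ b) (hT : 0 < T) (hr₀ : 0 < r₀)
    (hθb : θ + b * (p - 1) ≠ 0)
    (ζ R : ℝ → ℝ) (D : ℝ → ℝ → ℝ) (ψ : ℝ → ℝ)
    (hζ : ∀ s, ζ s = Real.exp (-(α + θ ^ 2 / 2) * T - θ * Real.sqrt T * s))
    (hR : ∀ s, R s = r₀ * Real.exp ((a - b ^ 2 / 2) * T + b * Real.sqrt T * s))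
    (hD : ∀ y r : ℝ, D y r =
      if 0 < y ∧ y < p * ((η₁ - 1) * r) ^ (p - 1)
        then (y / p) ^ (1 / (p - 1)) + r else 0)
    (hψ : ∀ l : ℝ, ψ l = ∫ s, ζ s * D (l * ζ s) (R s) ∂(gaussianReal 0 1)) :
    (∀ l > (0:ℝ),
      Integrable (fun s => ζ s * D (l * ζ s) (R s)) (gaussianReal 0 1)) ∧
    ContinuousOn ψ (Ioi 0) ∧
    StrictAntiOn ψ (Ioi 0) ∧
    Tendsto ψ (𝓝[>] 0) atTop ∧
    Tendsto ψ atTop (𝓝 0) ∧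
    ∀ x₀ > (0:ℝ), ∃! l : ℝ, l > 0 ∧ ψ l = x₀ := by
  have hc : 1 / (p - 1) < 0 := one_div_neg.2 (by linarith)
  have hk : 0 < η₁ - 1 := by linarith
  have hζpos : ∀ s, 0 < ζ s := fun s => by rw [hζ]; positivity
  have hRpos : ∀ s, 0 < R s := fun s => by rw [hR]; positivity
  set c := 1 / (p - 1) with hc_def
  let A : ℝ → ℝ := fun s => ζ s * (ζ s / p) ^ c
  let E : ℝ → ℝ := fun s => ζ s * R s
  let G : ℝ → ℝ := fun s => p * ((η₁ - 1) * R s) ^ (p - 1) / ζ s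
  have hζm : Measurable ζ := by rw [funext hζ]; fun_prop
  have hRm : Measurable R := by rw [funext hR]; fun_prop
  have hA : ∀ s, 0 < A s := fun s =>
    mul_pos (hζpos s) (Real.rpow_pos_of_pos (div_pos (hζpos s) hp) _)
  have hE : ∀ s, 0 < E s := fun s => mul_pos (hζpos s) (hRpos s)
  have hAm : Measurable A := hζm.mul ((hζm.div_const p).pow_const c)
  have hEm : Measurable E := hζm.mul hRm
  have hGm : Measurable G := (((hRm.const_mul _).pow_const _).const_mul _).div hζm
  set q := Real.sqrt T with hq
  have hqpos : 0 < q := Real.sqrt_pos.2 hT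
  set u := -(α + θ ^ 2 / 2) * T with hu
  set w := (a - b ^ 2 / 2) * T with hw
  have hAi : Integrable A (gaussianReal 0 1) := by
    have hAeq : A = fun s => (p ^ c)⁻¹ * Real.exp (u * (1 + c) + (-θ * q * (1 + c)) * s) := by
      funext s
      simp only [A]
      rw [Real.div_rpow (hζpos s).le hp.le, hζ, ← Real.exp_mul, ← mul_div_assoc,
        ← Real.exp_add, div_eq_inv_mul]
      congr 2
      ring
    rw [hAeq]
    exact (integrable_exp_affine_gaussianReal _ _).const_mul _
  have hEi : Integrable E (gaussianReal 0 1) := by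
    have hEeq : E = fun s => r₀ * Real.exp ((u + w) + (b * q - θ * q) * s) := by
      funext s
      simp only [E]
      rw [hζ, hR, mul_left_comm, ← Real.exp_add]
      congr 2
      ring
    rw [hEeq]
    exact (integrable_exp_affine_gaussianReal _ _).const_mul _
  have hGeq : ∀ s, G s = Real.exp ((Real.log (p * ((η₁ - 1) * r₀) ^ (p - 1)) + w * (p - 1) - u)
      + q * (θ + b * (p - 1)) * s) := by
    intro s
    have hpos : 0 < p * ((η₁ - 1) * r₀) ^ (p - 1) := by positivity
    have hexp : (Real.log (p * ((η₁ - 1) * r₀) ^ (p - 1)) + w * (p - 1) - u)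
        + q * (θ + b * (p - 1)) * s = Real.log (p * ((η₁ - 1) * r₀) ^ (p - 1))
          + (w + b * q * s) * (p - 1) - (u - θ * q * s) := by ring
    simp only [G]
    rw [hexp, Real.exp_sub, Real.exp_add, Real.exp_log hpos, Real.exp_mul, hζ, hR,
      ← mul_assoc (η₁ - 1), Real.mul_rpow (by positivity) (Real.exp_pos _).le, mul_assoc p]
  have hv : q * (θ + b * (p - 1)) ≠ 0 := mul_ne_zero hqpos.ne' hθb
  have hGpos : ∀ l, 0 < gaussianReal 0 1 {s | l < G s} := fun l => by
    simp only [hGeq]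
    exact gaussianReal_exp_affine_gt_pos _ hv l
  have hGne : ∀ l, ∀ᵐ s ∂gaussianReal 0 1, G s ≠ l := fun l => by
    simp only [hGeq]
    exact gaussianReal_ae_exp_affine_ne _ hv l
  have hF : ∀ l > 0, (fun s => ζ s * D (l * ζ s) (R s)) = thresholdPower c A E G l := by
    intro l hl
    funext s
    rw [hD]
    exact mul_ite_rpow_add_eq hp hl (hζpos s)
  have hψF : EqOn ψ (fun l => ∫ s, thresholdPower c A E G l s ∂gaussianReal 0 1) (Ioi 0) :=
    fun l hl => by rw [hψ, hF l hl]
  have hcont : ContinuousOn ψ (Ioi 0) :=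
    (continuousOn_integral_thresholdPower hc.le hA hE hAm hEm hGm hAi hEi hGne).congr hψF
  have hanti : StrictAntiOn ψ (Ioi 0) :=
    (strictAntiOn_integral_thresholdPower hc hA hE hAm hEm hGm hAi hEi hGpos).congr hψF.symm
  have hzero : Tendsto ψ (𝓝[>] 0) atTop :=
    (tendsto_integral_thresholdPower_nhdsGT_zero hc hA hE hAm hEm hGm hAi hEi hGpos).congr'
      (hψF.symm.eventuallyEq_of_mem self_mem_nhdsWithin)
  have htop : Tendsto ψ atTop (𝓝 0) :=
    (tendsto_integral_thresholdPower_atTop hc.le hA hE hAm hEm hGm hAi hEi).congr'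
      (hψF.symm.eventuallyEq_of_mem (Ioi_mem_atTop 0))
  refine ⟨fun l hl => ?_, hcont, hanti, hzero, htop,
    fun x₀ hx₀ => existsUnique_of_strictAntiOn_Ioi hcont hanti hzero htop hx₀⟩
  rw [hF l hl]
  exact integrable_thresholdPower hc.le hA hE hAm hEm hGm hAi hEi hl
end
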